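/- arXiv:2510.11272 — 6 statements merged into one kernel-verified Lean document; each statement's English description precedes it below -/
import Mathlib

section
/- Let R be a Bezout domain with field of fractions K. Then SL₂(K) = SL₂(R)·B₂⁺(K); that is, every matrix M ∈ SL₂(K) can be written as M = g·b, where g is the image in SL₂(K) of a matrix in SL₂(R) (under the map induced by the inclusion R → K) and b ∈ B₂⁺(K). -/
/-- In a Bezout domain every pair is a multiple of a unimodular pair. -/
theorem IsBezout.exists_eq_mul_isCoprime {R : Type*} [CommRing R] [IsDomain R] [IsBezout R]
    (x y : R) : ∃ g p q : R, x = g * p ∧ y = g * q ∧ IsCoprime p q := by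
  by_cases hg : IsBezout.gcd x y = 0
  · have hx : x = 0 := zero_dvd_iff.mp (hg ▸ IsBezout.gcd_dvd_left x y)
    have hy : y = 0 := zero_dvd_iff.mp (hg ▸ IsBezout.gcd_dvd_right x y)
    exact ⟨0, 1, 0, by simp [hx], by simp [hy], isCoprime_one_left⟩
  · obtain ⟨p, hp⟩ := IsBezout.gcd_dvd_left x y
    obtain ⟨q, hq⟩ := IsBezout.gcd_dvd_right x y
    obtain ⟨s, t, hst⟩ := IsBezout.gcd_eq_sum x y
    refine ⟨_, p, q, hp, hq, s, t, mul_left_cancel₀ hg ?_⟩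
    linear_combination hst - s * hp - t * hq

/-- Every point of the projective line over the fraction field of a Bezout domain has
unimodular homogeneous coordinates. -/
theorem IsFractionRing.exists_isCoprime_mul_eq_mul {R : Type*} [CommRing R] [IsDomain R]
    [IsBezout R] {K : Type*} [Field K] [Algebra R K] [IsFractionRing R K] (a c : K) :
    ∃ p q : R, IsCoprime p q ∧ algebraMap R K p * c = algebraMap R K q * a := by
  obtain ⟨x, y, d, hd, rfl, rfl⟩ : ∃ x y d : R, algebraMap R K d ≠ 0 ∧
      algebraMap R K x / algebraMap R K d = a ∧ algebraMap R K y / algebraMap R K d = c := by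
    obtain ⟨x, d, hd, rfl⟩ := IsFractionRing.div_surjective (A := R) a
    obtain ⟨y, e, he, rfl⟩ := IsFractionRing.div_surjective (A := R) c
    have hd' := IsFractionRing.to_map_ne_zero_of_mem_nonZeroDivisors (K := K) hd
    have he' := IsFractionRing.to_map_ne_zero_of_mem_nonZeroDivisors (K := K) he
    refine ⟨x * e, y * d, d * e, ?_, ?_, ?_⟩ <;> simp only [map_mul]
    · exact mul_ne_zero hd' he'
    · field_simp
    · field_simp
  obtain ⟨g, p, q, rfl, rfl, hpq⟩ := IsBezout.exists_eq_mul_isCoprime x y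
  refine ⟨p, q, hpq, ?_⟩
  simp only [map_mul]
  ring


/-- Let `R` be a Bezout domain with field of fractions `K`. Then
`SL₂(K) = SL₂(R) · B₂⁺(K)`: every `M ∈ SL₂(K)` factors as `M = g · b` with `g` the image of a
matrix in `SL₂(R)` and `b` upper triangular in `SL₂(K)`. -/
theorem sl2_fractionField_eq_sl2R_mul_upperTriangular
    (R : Type*) [CommRing R] [IsDomain R] [IsBezout R]
    (K : Type*) [Field K] [Algebra R K] [IsFractionRing R K]
    (M : Matrix.SpecialLinearGroup (Fin 2) K) :
    ∃ (g : Matrix.SpecialLinearGroup (Fin 2) R) (b : Matrix.SpecialLinearGroup (Fin 2) K),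
      (b : Matrix (Fin 2) (Fin 2) K) 1 0 = 0 ∧
      M = Matrix.SpecialLinearGroup.map (algebraMap R K) g * b := by
  obtain ⟨p, q, ⟨u, v, huv⟩, h⟩ :=
    IsFractionRing.exists_isCoprime_mul_eq_mul (R := R) (M 0 0) (M 1 0)
  let g : Matrix.SpecialLinearGroup (Fin 2) R :=
    ⟨!![p, -v; q, u], by rw [Matrix.det_fin_two_of]; linear_combination huv⟩
  refine ⟨g, (Matrix.SpecialLinearGroup.map (algebraMap R K) g)⁻¹ * M, ?_,
    (mul_inv_cancel_left _ _).symm⟩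
  have h₀ : Matrix.SpecialLinearGroup.map (algebraMap R K) g 0 0 = algebraMap R K p := rfl
  have h₁ : Matrix.SpecialLinearGroup.map (algebraMap R K) g 1 0 = algebraMap R K q := rfl
  rw [Matrix.SpecialLinearGroup.coe_mul, Matrix.SpecialLinearGroup.coe_inv,
    Matrix.adjugate_fin_two, Matrix.mul_apply, Fin.sum_univ_two]
  simp only [Matrix.of_apply, Matrix.cons_val', Matrix.cons_val_zero, Matrix.cons_val_one,
    Matrix.cons_val_fin_one, h₀, h₁]
  linear_combination h
end

section
/- Let R be a local ring. The group presented by generators {x₊(r), x₋(r) : r ∈ R} subject to the relations (1) x₊(a)x₊(b) = x₊(a+b) and x₋(a)x₋(b) = x₋(a+b) for all a,b ∈ R; (2) s̃(r)·x₊(a)·s̃(r)⁻¹ = x₋(a·r⁻²) and s̃(r)·x₋(a)·s̃(r)⁻¹ = x₊(a·r²) for all a ∈ R and r ∈ R^×, where s̃(r) := x₊(r)x₋(r⁻¹)x₊(r); (3) r^h·s^h = (rs)^h for all r,s ∈ R^×, where u^h := s̃(1)⁻¹·s̃(u), is isomorphic to SL₂(R), via the map sending x₊(r) to the matrix with rows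 (1, r) and (0, 1), and x₋(r) to the matrix with rows (1, 0) and (−r, 1). -/
/-! **Statement 2.** Cohn's presentation of `SL₂(R)` over a local ring `R`. -/

namespace SL2Presentation

variable (R : Type) [CommRing R]

/-- The free-group generator `x₊(r)`. -/
def xp (r : R) : FreeGroup (R ⊕ R) := FreeGroup.of (Sum.inl r)

/-- The free-group generator `x₋(r)`. -/
def xm (r : R) : FreeGroup (R ⊕ R) := FreeGroup.of (Sum.inr r)

/-- `s̃(r) := x₊(r) x₋(r⁻¹) x₊(r)` for a unit `r`. -/
def st (r : Rˣ) : FreeGroup (R ⊕ R) := xp R (r : R) * xm R ((r⁻¹ : Rˣ) : R) * xp R (r : R)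

/-- `u^h := s̃(1)⁻¹ · s̃(u)` for a unit `u`. -/
def hgen (u : Rˣ) : FreeGroup (R ⊕ R) := (st R 1)⁻¹ * st R u

/-- The defining relators of the presentation:
(1) `x₊(a)x₊(b) = x₊(a+b)` and `x₋(a)x₋(b) = x₋(a+b)`;
(2) `s̃(r)x₊(a)s̃(r)⁻¹ = x₋(a·r⁻²)` and `s̃(r)x₋(a)s̃(r)⁻¹ = x₊(a·r²)` for units `r`;
(3) `r^h · s^h = (rs)^h` for units `r, s`. -/
def rels : Set (FreeGroup (R ⊕ R)) :=
  { w | (∃ a b : R, w = xp R a * xp R b * (xp R (a + b))⁻¹) ∨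
        (∃ a b : R, w = xm R a * xm R b * (xm R (a + b))⁻¹) ∨
        (∃ (a : R) (r : Rˣ),
          w = st R r * xp R a * (st R r)⁻¹ *
              (xm R (a * ((r⁻¹ : Rˣ) : R) * ((r⁻¹ : Rˣ) : R)))⁻¹) ∨
        (∃ (a : R) (r : Rˣ),
          w = st R r * xm R a * (st R r)⁻¹ * (xp R (a * (r : R) * (r : R)))⁻¹) ∨
        (∃ r s : Rˣ, w = hgen R r * hgen R s * (hgen R (r * s))⁻¹) }

/-- The elementary matrix `(1, r; 0, 1)` in `SL₂(R)`. -/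
def Eplus (r : R) : Matrix.SpecialLinearGroup (Fin 2) R :=
  ⟨!![1, r; 0, 1], by simp [Matrix.det_fin_two_of]⟩

/-- The elementary matrix `(1, 0; -r, 1)` in `SL₂(R)`. -/
def Eminus (r : R) : Matrix.SpecialLinearGroup (Fin 2) R :=
  ⟨!![1, 0; -r, 1], by simp [Matrix.det_fin_two_of]⟩

namespace Presented

variable {R : Type} [CommRing R]

/-- The image of `x₊(r)` in the presented group. -/
def upper (r : R) : PresentedGroup (rels R) := PresentedGroup.of (Sum.inl r)

/-- The image of `x₋(r)` in the presented group. -/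
def lower (r : R) : PresentedGroup (rels R) := PresentedGroup.of (Sum.inr r)

/-- The image of `s̃(r)` in the presented group. -/
def weyl (r : Rˣ) : PresentedGroup (rels R) := upper (r : R) * lower ((r⁻¹ : Rˣ) : R) * upper (r : R)

/-- The image of `r^h` in the presented group. -/
def torus (r : Rˣ) : PresentedGroup (rels R) := (weyl 1)⁻¹ * weyl r

theorem upper_mul_upper (a b : R) : upper a * upper b = upper (a + b) := by
  have h : PresentedGroup.mk (rels R) (xp R a * xp R b * (xp R (a + b))⁻¹) = 1 :=
    PresentedGroup.one_of_mem (Or.inl ⟨a, b, rfl⟩)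
  rw [map_mul, map_inv, mul_inv_eq_one] at h
  exact h

theorem lower_mul_lower (a b : R) : lower a * lower b = lower (a + b) := by
  have h : PresentedGroup.mk (rels R) (xm R a * xm R b * (xm R (a + b))⁻¹) = 1 :=
    PresentedGroup.one_of_mem (Or.inr (Or.inl ⟨a, b, rfl⟩))
  rw [map_mul, map_inv, mul_inv_eq_one] at h
  exact h

theorem weyl_mul_upper (r : Rˣ) (a : R) :
    weyl r * upper a = lower (a * ((r⁻¹ : Rˣ) : R) * ((r⁻¹ : Rˣ) : R)) * weyl r := by
  have h : PresentedGroup.mk (rels R) (st R r * xp R a * (st R r)⁻¹ *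
      (xm R (a * ((r⁻¹ : Rˣ) : R) * ((r⁻¹ : Rˣ) : R)))⁻¹) = 1 :=
    PresentedGroup.one_of_mem (Or.inr (Or.inr (Or.inl ⟨a, r, rfl⟩)))
  rw [map_mul, map_inv, mul_inv_eq_one, map_mul, map_inv, mul_inv_eq_iff_eq_mul] at h
  exact h

theorem weyl_mul_lower (r : Rˣ) (a : R) :
    weyl r * lower a = upper (a * (r : R) * (r : R)) * weyl r := by
  have h : PresentedGroup.mk (rels R) (st R r * xm R a * (st R r)⁻¹ *
      (xp R (a * (r : R) * (r : R)))⁻¹) = 1 :=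
    PresentedGroup.one_of_mem (Or.inr (Or.inr (Or.inr (Or.inl ⟨a, r, rfl⟩))))
  rw [map_mul, map_inv, mul_inv_eq_one, map_mul, map_inv, mul_inv_eq_iff_eq_mul] at h
  exact h

theorem torus_mul_torus (r s : Rˣ) : torus r * torus s = torus (r * s) := by
  have h : PresentedGroup.mk (rels R) (hgen R r * hgen R s * (hgen R (r * s))⁻¹) = 1 :=
    PresentedGroup.one_of_mem (Or.inr (Or.inr (Or.inr (Or.inr ⟨r, s, rfl⟩))))
  rw [map_mul, map_inv, mul_inv_eq_one] at h
  exact h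

theorem upper_zero : upper (0 : R) = 1 := by
  simpa using upper_mul_upper (0 : R) 0

theorem lower_zero : lower (0 : R) = 1 := by
  simpa using lower_mul_lower (0 : R) 0

theorem upper_neg (a : R) : upper (-a) = (upper a)⁻¹ := by
  rw [eq_inv_iff_mul_eq_one, upper_mul_upper, neg_add_cancel, upper_zero]

theorem lower_neg (a : R) : lower (-a) = (lower a)⁻¹ := by
  rw [eq_inv_iff_mul_eq_one, lower_mul_lower, neg_add_cancel, lower_zero]

theorem torus_one : torus (1 : Rˣ) = 1 := by
  simp [torus]

theorem torus_inv (r : Rˣ) : torus r⁻¹ = (torus r)⁻¹ := by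
  rw [eq_inv_iff_mul_eq_one, torus_mul_torus, inv_mul_cancel, torus_one]

theorem weyl_eq (r : Rˣ) : weyl r = weyl 1 * torus r := by
  simp [torus]

theorem weyl_one_mul_upper (a : R) : weyl 1 * upper a = lower a * weyl 1 := by
  simpa using weyl_mul_upper 1 a

theorem weyl_one_mul_lower (a : R) : weyl 1 * lower a = upper a * weyl 1 := by
  simpa using weyl_mul_lower 1 a

theorem torus_mul_upper (r : Rˣ) (a : R) :
    torus r * upper a = upper (a * ((r⁻¹ : Rˣ) : R) * ((r⁻¹ : Rˣ) : R)) * torus r := by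
  rw [torus, mul_assoc, weyl_mul_upper, inv_mul_eq_iff_eq_mul, ← mul_assoc, ← mul_assoc,
    weyl_one_mul_upper, mul_assoc (lower _), mul_inv_cancel, mul_one]

theorem torus_mul_lower (r : Rˣ) (a : R) :
    torus r * lower a = lower (a * (r : R) * (r : R)) * torus r := by
  rw [torus, mul_assoc, weyl_mul_lower, inv_mul_eq_iff_eq_mul, ← mul_assoc, ← mul_assoc,
    weyl_one_mul_lower, mul_assoc (upper _), mul_inv_cancel, mul_one]

theorem weyl_neg (r : Rˣ) : weyl (-r) = (weyl r)⁻¹ := by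
  simp [weyl, inv_neg, upper_neg, lower_neg, mul_assoc]

theorem weyl_mul_weyl (r s : Rˣ) : weyl r * weyl s = torus ((-r)⁻¹ * s) := by
  rw [← torus_mul_torus, torus_inv, torus, torus, weyl_neg]
  group

theorem lower_eq_upper_mul_weyl_mul_upper (t : Rˣ) :
    lower (t : R) = upper (-((t⁻¹ : Rˣ) : R)) * weyl t⁻¹ * upper (-((t⁻¹ : Rˣ) : R)) := by
  simp only [weyl, upper_neg, inv_inv]
  group

theorem upper_eq_lower_mul_weyl_mul_lower (r : Rˣ) :
    upper (r : R) = lower (-((r⁻¹ : Rˣ) : R)) * weyl r * lower (-((r⁻¹ : Rˣ) : R)) := by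
  have h := weyl_mul_upper r (r : R)
  rw [Units.mul_inv, one_mul] at h
  rw [lower_neg, mul_assoc, eq_inv_mul_iff_mul_eq, eq_mul_inv_iff_mul_eq]
  refine mul_right_cancel (b := upper (r : R)) ?_
  rw [h, weyl]
  group

/-- The elements of the form `x₋(t) u^h x₊(a)`. -/
def bigCell (R : Type) [CommRing R] : Set (PresentedGroup (rels R)) :=
  {g | ∃ (t : R) (u : Rˣ) (a : R), g = lower t * torus u * upper a}

theorem lower_mul_mem_bigCell (r : R) {g : PresentedGroup (rels R)} (hg : g ∈ bigCell R) :
    lower r * g ∈ bigCell R := by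
  obtain ⟨t, u, a, rfl⟩ := hg
  exact ⟨r + t, u, a, by rw [← lower_mul_lower]; group⟩

theorem torus_mul_mem_bigCell (r : Rˣ) {g : PresentedGroup (rels R)} (hg : g ∈ bigCell R) :
    torus r * g ∈ bigCell R := by
  obtain ⟨t, u, a, rfl⟩ := hg
  refine ⟨t * r * r, r * u, a, ?_⟩
  rw [← torus_mul_torus, ← mul_assoc, ← mul_assoc, torus_mul_lower]
  group

theorem mul_upper_mem_bigCell (r : R) {g : PresentedGroup (rels R)} (hg : g ∈ bigCell R) :
    g * upper r ∈ bigCell R := by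
  obtain ⟨t, u, a, rfl⟩ := hg
  exact ⟨t, u, a + r, by rw [← upper_mul_upper]; group⟩

theorem mul_torus_mem_bigCell (r : Rˣ) {g : PresentedGroup (rels R)} (hg : g ∈ bigCell R) :
    g * torus r ∈ bigCell R := by
  obtain ⟨t, u, a, rfl⟩ := hg
  refine ⟨t, u * r, a * r * r, ?_⟩
  have h := torus_mul_upper r (a * r * r)
  simp only [Units.mul_inv_cancel_right] at h
  simp only [← torus_mul_torus, mul_assoc] at h ⊢
  rw [h]

/-- The union of the big cell with its translate by `s̃(1)`. -/
def cells (R : Type) [CommRing R] : Set (PresentedGroup (rels R)) :=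
  {g | g ∈ bigCell R ∨ ∃ k ∈ bigCell R, g = weyl 1 * k}

theorem weyl_one_mul_mem_cells {g : PresentedGroup (rels R)} (hg : g ∈ cells R) :
    weyl 1 * g ∈ cells R := by
  obtain hg | ⟨k, hk, rfl⟩ := hg
  · exact Or.inr ⟨g, hg, rfl⟩
  · left
    rw [← mul_assoc, weyl_mul_weyl]
    exact torus_mul_mem_bigCell _ hk

theorem mul_upper_mem_cells (r : R) {g : PresentedGroup (rels R)} (hg : g ∈ cells R) :
    g * upper r ∈ cells R := by
  obtain hg | ⟨k, hk, rfl⟩ := hg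
  · exact Or.inl (mul_upper_mem_bigCell r hg)
  · exact Or.inr ⟨_, mul_upper_mem_bigCell r hk, mul_assoc _ _ _⟩

theorem mul_torus_mem_cells (r : Rˣ) {g : PresentedGroup (rels R)} (hg : g ∈ cells R) :
    g * torus r ∈ cells R := by
  obtain hg | ⟨k, hk, rfl⟩ := hg
  · exact Or.inl (mul_torus_mem_bigCell r hg)
  · exact Or.inr ⟨_, mul_torus_mem_bigCell r hk, mul_assoc _ _ _⟩

theorem upper_mul_lower_unit_mem_cells (r : R) (t : Rˣ) : upper r * lower (t : R) ∈ cells R := by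
  rw [lower_eq_upper_mul_weyl_mul_upper, ← mul_assoc, ← mul_assoc, upper_mul_upper]
  refine mul_upper_mem_cells _ (Or.inr ?_)
  rw [weyl_eq, ← mul_assoc, ← weyl_one_mul_lower]
  exact ⟨_, mul_torus_mem_bigCell _ ⟨_, 1, 0, by rw [torus_one, upper_zero, mul_one, mul_one]⟩,
    mul_assoc _ _ _⟩

theorem upper_unit_mul_lower_eq {r v : Rˣ} {t : R} (hv : (v : R) = t - ((r⁻¹ : Rˣ) : R)) :
    upper (r : R) * lower t = lower (-(t * ((v⁻¹ : Rˣ) : R) * ((r⁻¹ : Rˣ) : R))) *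
      torus ((-r)⁻¹ * v⁻¹) * upper (-((v⁻¹ : Rˣ) : R)) := by
  have ht : -(t * ((v⁻¹ : Rˣ) : R) * ((r⁻¹ : Rˣ) : R)) = -((r⁻¹ : Rˣ) : R) +
      -((v⁻¹ : Rˣ) : R) * ((r⁻¹ : Rˣ) : R) * ((r⁻¹ : Rˣ) : R) := by
    have h1 := Units.mul_inv v
    rw [eq_sub_iff_add_eq.mp hv |>.symm]
    linear_combination (-((r⁻¹ : Rˣ) : R)) * h1
  rw [upper_eq_lower_mul_weyl_mul_lower, mul_assoc (_ * _), lower_mul_lower, neg_add_eq_sub, ← hv,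
    lower_eq_upper_mul_weyl_mul_upper, ht, ← lower_mul_lower, ← weyl_mul_weyl]
  have h := weyl_mul_upper r (-((v⁻¹ : Rˣ) : R))
  simp only [mul_assoc] at h ⊢
  rw [← mul_assoc (weyl r), h]
  simp only [mul_assoc]

variable [IsLocalRing R]

theorem isUnit_sub_of_not_isUnit {t : R} (ht : ¬ IsUnit t) (r : Rˣ) : IsUnit (t - (r : R)) := by
  by_contra h
  have := (IsLocalRing.mem_maximalIdeal _).mpr ht
  have h2 := Ideal.sub_mem _ this ((IsLocalRing.mem_maximalIdeal _).mpr h)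
  rw [sub_sub_cancel, IsLocalRing.mem_maximalIdeal] at h2
  exact h2 r.isUnit

theorem exists_upper_unit_mul_lower {t : R} (ht : ¬ IsUnit t) (r : Rˣ) :
    ∃ (t' : R) (u : Rˣ) (a : R), ¬ IsUnit t' ∧
      upper (r : R) * lower t = lower t' * torus u * upper a := by
  obtain ⟨v, hv⟩ := isUnit_sub_of_not_isUnit ht r⁻¹
  refine ⟨_, _, _, ?_, upper_unit_mul_lower_eq hv⟩
  rwa [IsUnit.neg_iff, Units.isUnit_mul_units, Units.isUnit_mul_units]

theorem upper_mul_lower_mem_cells (r t : R) : upper r * lower t ∈ cells R := by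
  by_cases ht : IsUnit t
  · obtain ⟨t, rfl⟩ := ht
    exact upper_mul_lower_unit_mem_cells r t
  by_cases hr : IsUnit r
  · obtain ⟨r, rfl⟩ := hr
    obtain ⟨t', u, a, -, h⟩ := exists_upper_unit_mul_lower ht r
    exact Or.inl ⟨t', u, a, h⟩
  obtain ⟨q, hq⟩ := isUnit_sub_of_not_isUnit hr 1
  obtain ⟨t', u, a, ht', h⟩ := exists_upper_unit_mul_lower ht q
  obtain ⟨t₂, u₂, a₂, -, h₂⟩ := exists_upper_unit_mul_lower ht' 1
  have hr' : r = ((1 : Rˣ) : R) + q := by rw [hq]; ring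
  rw [hr', ← upper_mul_upper, mul_assoc, h, ← mul_assoc, ← mul_assoc, h₂]
  exact Or.inl (mul_upper_mem_bigCell _ (mul_torus_mem_bigCell _ ⟨t₂, u₂, a₂, rfl⟩))

theorem upper_mul_mem_cells (r : R) {g : PresentedGroup (rels R)} (hg : g ∈ cells R) :
    upper r * g ∈ cells R := by
  obtain ⟨t, u, a, rfl⟩ | ⟨k, hk, rfl⟩ := hg
  · rw [← mul_assoc, ← mul_assoc]
    exact mul_upper_mem_cells _ (mul_torus_mem_cells _ (upper_mul_lower_mem_cells r t))
  · rw [← mul_assoc, ← weyl_one_mul_lower, mul_assoc]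
    exact Or.inr ⟨_, lower_mul_mem_bigCell r hk, rfl⟩

theorem lower_mul_mem_cells (r : R) {g : PresentedGroup (rels R)} (hg : g ∈ cells R) :
    lower r * g ∈ cells R := by
  obtain hg | ⟨k, hk, rfl⟩ := hg
  · exact Or.inl (lower_mul_mem_bigCell r hg)
  · rw [← mul_assoc, ← weyl_one_mul_upper, mul_assoc]
    exact weyl_one_mul_mem_cells (upper_mul_mem_cells r (Or.inl hk))

theorem mem_cells (g : PresentedGroup (rels R)) : g ∈ cells R := by
  have hg : g ∈ Subgroup.closure (Set.range (PresentedGroup.of : R ⊕ R → PresentedGroup (rels R))) :=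
    PresentedGroup.closure_range_of (rels R) ▸ Subgroup.mem_top g
  induction hg using Subgroup.closure_induction_left with
  | one => exact Or.inl ⟨0, 1, 0, by simp [lower_zero, upper_zero, torus_one]⟩
  | mul_left x hx y _ ih =>
    obtain ⟨r | r, rfl⟩ := hx
    · exact upper_mul_mem_cells r ih
    · exact lower_mul_mem_cells r ih
  | inv_mul_cancel x hx y _ ih =>
    obtain ⟨r | r, rfl⟩ := hx
    · exact upper_neg r ▸ upper_mul_mem_cells (-r) ih
    · exact lower_neg r ▸ lower_mul_mem_cells (-r) ih

end Presented

open Presented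

section Matrices

variable {R : Type} [CommRing R]

/-- The monomial matrix `(0, r; -r⁻¹, 0)`. -/
def monomialMatrix (r : Rˣ) : Matrix.SpecialLinearGroup (Fin 2) R :=
  ⟨!![0, (r : R); -((r⁻¹ : Rˣ) : R), 0], by simp [Matrix.det_fin_two_of]⟩

/-- The diagonal matrix `(r⁻¹, 0; 0, r)`. -/
def diagonalMatrix (r : Rˣ) : Matrix.SpecialLinearGroup (Fin 2) R :=
  ⟨!![((r⁻¹ : Rˣ) : R), 0; 0, (r : R)], by simp [Matrix.det_fin_two_of]⟩

theorem coe_Eplus (r : R) : (Eplus R r : Matrix (Fin 2) (Fin 2) R) = !![1, r; 0, 1] := rfl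

theorem coe_Eminus (r : R) : (Eminus R r : Matrix (Fin 2) (Fin 2) R) = !![1, 0; -r, 1] := rfl

theorem coe_monomialMatrix (r : Rˣ) : (monomialMatrix r : Matrix (Fin 2) (Fin 2) R) =
    !![0, (r : R); -((r⁻¹ : Rˣ) : R), 0] := rfl

theorem coe_diagonalMatrix (r : Rˣ) : (diagonalMatrix r : Matrix (Fin 2) (Fin 2) R) =
    !![((r⁻¹ : Rˣ) : R), 0; 0, (r : R)] := rfl

theorem Eplus_mul_Eminus_mul_Eplus (r : Rˣ) :
    Eplus R (r : R) * Eminus R ((r⁻¹ : Rˣ) : R) * Eplus R (r : R) = monomialMatrix r := by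
  apply Subtype.ext
  simp [coe_Eplus, coe_Eminus, coe_monomialMatrix]

theorem inv_monomialMatrix_one_mul (r : Rˣ) :
    (monomialMatrix (1 : Rˣ))⁻¹ * monomialMatrix r = diagonalMatrix r := by
  rw [inv_mul_eq_iff_eq_mul]
  apply Subtype.ext
  simp [coe_diagonalMatrix, coe_monomialMatrix]

/-- The assignment `x₊(r) ↦ (1, r; 0, 1)`, `x₋(r) ↦ (1, 0; -r, 1)` on generators. -/
def generatorMatrix (R : Type) [CommRing R] : R ⊕ R → Matrix.SpecialLinearGroup (Fin 2) R :=
  Sum.elim (Eplus R) (Eminus R)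

theorem lift_st (r : Rˣ) : FreeGroup.lift (generatorMatrix R) (st R r) = monomialMatrix r := by
  rw [← Eplus_mul_Eminus_mul_Eplus]
  simp [st, xp, xm, generatorMatrix]

theorem lift_hgen (r : Rˣ) : FreeGroup.lift (generatorMatrix R) (hgen R r) = diagonalMatrix r := by
  rw [hgen, map_mul, map_inv, lift_st, lift_st, inv_monomialMatrix_one_mul]

theorem lift_eq_one_of_mem_rels (w : FreeGroup (R ⊕ R)) (hw : w ∈ rels R) :
    FreeGroup.lift (generatorMatrix R) w = 1 := by
  have hp (r : R) : FreeGroup.lift (generatorMatrix R) (xp R r) = Eplus R r := by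
    simp [xp, generatorMatrix]
  have hm (r : R) : FreeGroup.lift (generatorMatrix R) (xm R r) = Eminus R r := by
    simp [xm, generatorMatrix]
  obtain ⟨a, b, rfl⟩ | ⟨a, b, rfl⟩ | ⟨a, r, rfl⟩ | ⟨a, r, rfl⟩ | ⟨r, s, rfl⟩ := hw
  all_goals
    simp only [map_mul, map_inv, hp, hm, lift_st, lift_hgen, mul_inv_eq_iff_eq_mul, one_mul]
    apply Subtype.ext
    simp [coe_Eplus, coe_Eminus, coe_monomialMatrix, coe_diagonalMatrix, mul_assoc]
  exacts [add_comm _ _, add_comm _ _, mul_comm _ _, mul_comm _ _, mul_comm _ _]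

/-- The homomorphism from the presented group to `SL₂(R)`. -/
def toSL2 (R : Type) [CommRing R] : PresentedGroup (rels R) →* Matrix.SpecialLinearGroup (Fin 2) R :=
  PresentedGroup.toGroup (lift_eq_one_of_mem_rels (R := R))

theorem toSL2_upper (r : R) : toSL2 R (upper r) = Eplus R r :=
  PresentedGroup.toGroup.of _

theorem toSL2_lower (r : R) : toSL2 R (lower r) = Eminus R r :=
  PresentedGroup.toGroup.of _

theorem toSL2_weyl (r : Rˣ) : toSL2 R (weyl r) = monomialMatrix r := by
  rw [weyl, map_mul, map_mul, toSL2_upper, toSL2_lower, Eplus_mul_Eminus_mul_Eplus]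

theorem toSL2_torus (r : Rˣ) : toSL2 R (torus r) = diagonalMatrix r := by
  rw [torus, map_mul, map_inv, toSL2_weyl, toSL2_weyl, inv_monomialMatrix_one_mul]

theorem toSL2_lower_mul_torus_mul_upper (t : R) (u : Rˣ) (a : R) :
    (toSL2 R (lower t * torus u * upper a) : Matrix (Fin 2) (Fin 2) R) =
      !![((u⁻¹ : Rˣ) : R), ((u⁻¹ : Rˣ) : R) * a;
        -t * ((u⁻¹ : Rˣ) : R), -t * ((u⁻¹ : Rˣ) : R) * a + u] := by
  rw [map_mul, map_mul, toSL2_upper, toSL2_lower, toSL2_torus]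
  simp [coe_Eplus, coe_Eminus, coe_diagonalMatrix]

theorem toSL2_injective [IsLocalRing R] : Function.Injective (toSL2 R) := by
  rw [injective_iff_map_eq_one]
  intro g hg
  obtain ⟨t, u, a, rfl⟩ | ⟨k, ⟨t, u, a, rfl⟩, rfl⟩ := mem_cells g
  · have h := congrArg (fun A : Matrix.SpecialLinearGroup (Fin 2) R =>
      (A : Matrix (Fin 2) (Fin 2) R)) hg
    simp only [toSL2_lower_mul_torus_mul_upper] at h
    have h00 := congrFun (congrFun h 0) 0
    have h01 := congrFun (congrFun h 0) 1
    have h10 := congrFun (congrFun h 1) 0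
    obtain rfl : u = 1 := by simpa using h00
    obtain rfl : a = 0 := by simpa using h01
    obtain rfl : t = 0 := by simpa using h10
    simp [lower_zero, upper_zero, torus_one]
  · rw [map_mul, toSL2_weyl, mul_eq_one_iff_inv_eq] at hg
    have h := congrArg (fun A : Matrix.SpecialLinearGroup (Fin 2) R =>
      (A : Matrix (Fin 2) (Fin 2) R)) hg
    simp only [toSL2_lower_mul_torus_mul_upper] at h
    have h00 := congrFun (congrFun h 0) 0
    simp [coe_monomialMatrix, Matrix.adjugate_fin_two] at h00
    exact absurd h00.symm u⁻¹.ne_zero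

theorem mem_range_toSL2_of_isUnit {A : Matrix.SpecialLinearGroup (Fin 2) R}
    (hA : IsUnit (A.1 0 0)) : A ∈ (toSL2 R).range := by
  obtain ⟨u, hu⟩ := hA
  refine ⟨lower (-(A.1 1 0 * ((u⁻¹ : Rˣ) : R))) * torus u⁻¹ *
    upper (((u⁻¹ : Rˣ) : R) * A.1 0 1), Subtype.ext ?_⟩
  have hdet := A.2
  rw [Matrix.det_fin_two, ← hu] at hdet
  have h11 : A.1 1 0 * (((u⁻¹ : Rˣ) : R) * A.1 0 1) + ((u⁻¹ : Rˣ) : R) = A.1 1 1 := by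
    linear_combination (A.1 1 1) * Units.mul_inv u - ((u⁻¹ : Rˣ) : R) * hdet
  rw [toSL2_lower_mul_torus_mul_upper]
  ext i j
  fin_cases i <;> fin_cases j <;> simp [← hu, h11]

theorem toSL2_surjective [IsLocalRing R] : Function.Surjective (toSL2 R) := by
  intro A
  rw [← MonoidHom.mem_range]
  by_cases hA : IsUnit (A.1 0 0)
  · exact mem_range_toSL2_of_isUnit hA
  have hdet := A.2
  rw [Matrix.det_fin_two, sub_eq_add_neg] at hdet
  have h10 : IsUnit (A.1 1 0) := by
    obtain h | h := IsLocalRing.isUnit_or_isUnit_of_add_one hdet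
    · exact absurd (isUnit_of_mul_isUnit_left h) hA
    · exact isUnit_of_mul_isUnit_right (IsUnit.neg_iff _ |>.mp h)
  rw [← Subgroup.mul_mem_cancel_left _ (⟨weyl 1, toSL2_weyl 1⟩ : monomialMatrix 1 ∈ (toSL2 R).range)]
  refine mem_range_toSL2_of_isUnit ?_
  have h : (monomialMatrix 1 * A).1 0 0 = A.1 1 0 := by
    simp [coe_monomialMatrix, Matrix.mul_apply]
  rwa [h]

end Matrices

/-- If `R` is a local ring, the group presented by the generators
`x₊(r), x₋(r)` (`r ∈ R`) and the relations (1), (2), (3) is isomorphic to `SL₂(R)`, via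
`x₊(r) ↦ (1, r; 0, 1)` and `x₋(r) ↦ (1, 0; -r, 1)`. -/
theorem presentedGroup_iso_SL2 (R : Type) [CommRing R] [IsLocalRing R] :
    ∃ φ : PresentedGroup (rels R) ≃* Matrix.SpecialLinearGroup (Fin 2) R,
      (∀ r : R, φ (PresentedGroup.of (Sum.inl r)) = Eplus R r) ∧
      (∀ r : R, φ (PresentedGroup.of (Sum.inr r)) = Eminus R r) := by
  exact ⟨MulEquiv.ofBijective (toSL2 R) ⟨toSL2_injective, toSL2_surjective⟩, toSL2_upper, toSL2_lower⟩

end SL2Presentation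
end

section
/- Let 𝒞 be a simply connected twin chamber system over a set I. Then the chamber system Opp(𝒞) is simply connected. -/
/-! ## Chamber systems, galleries, homotopy, and twin chamber systems -/

namespace TwinChamber

universe u v

variable {I : Type u} {C : Type v}

/-- Two chambers are `i`-adjacent for some `i ∈ J`. -/
def JAdj (adj : I → C → C → Prop) (J : Set I) (c d : C) : Prop := ∃ j ∈ J, adj j c d

/-- Two chambers are adjacent if they are `i`-adjacent for some `i ∈ I`. -/
def Adj (adj : I → C → C → Prop) (c d : C) : Prop := ∃ i, adj i c d

/-- A gallery is a nonempty finite sequence of chambers in which consecutive chambers are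
adjacent. -/
def IsGallery (adj : I → C → C → Prop) (l : List C) : Prop :=
  l ≠ [] ∧ l.Chain' (Adj adj)

/-- `d` lies in the `J`-residue of `c`: there is a `J`-gallery from `c` to `d`. -/
def InResidue (adj : I → C → C → Prop) (J : Set I) (c d : C) : Prop :=
  Relation.ReflTransGen (JAdj adj J) c d

/-- Two galleries are elementary homotopic if they coincide on an initial segment and a final
segment, and the two intermediate subgalleries are `J`-galleries, with the same first and last
chambers, for some `J ⊆ I` with `|J| ≤ 2`. -/
def ElemHomotopic (adj : I → C → C → Prop) (G H : List C) : Prop :=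
  ∃ (P M M' S : List C) (J : Set I),
    J.Finite ∧ J.ncard ≤ 2 ∧
    M ≠ [] ∧ M' ≠ [] ∧
    M.head? = M'.head? ∧ M.getLast? = M'.getLast? ∧
    M.Chain' (JAdj adj J) ∧ M'.Chain' (JAdj adj J) ∧
    G = P ++ M ++ S ∧ H = P ++ M' ++ S

/-- Two galleries are homotopic if they are connected by a finite chain of elementary
homotopies. -/
def Homotopic (adj : I → C → C → Prop) : List C → List C → Prop :=
  Relation.ReflTransGen (ElemHomotopic adj)

/-- A closed gallery is null-homotopic if it is homotopic to the length-zero gallery at its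
initial chamber. -/
def NullHomotopic (adj : I → C → C → Prop) (G : List C) : Prop :=
  ∃ c, G.head? = some c ∧ Homotopic adj G [c]

/-- A chamber system is connected if any two chambers are joined by a gallery. -/
def Connected (adj : I → C → C → Prop) : Prop :=
  ∀ c d : C, Relation.ReflTransGen (Adj adj) c d

/-- A chamber system is simply connected if it is connected and every closed gallery is
null-homotopic. -/
def SimplyConnected (adj : I → C → C → Prop) : Prop :=
  Connected adj ∧
    ∀ G : List C, IsGallery adj G → G.head? = G.getLast? → NullHomotopic adj G

/-- The reduced gallery of a gallery: delete every chamber equal to its immediate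
predecessor. -/
noncomputable def reduced (l : List C) : List C :=
  letI : DecidableEq C := Classical.decEq C
  l.destutter (· ≠ ·)

/-- A twin chamber system over `I`: a pair of chamber systems `(Cp, adjp)`, `(Cm, adjm)` over
`I` (each `adj i` an equivalence relation) together with a symmetric opposition relation `op`
between them, satisfying the axioms (TCS1)–(TCS4) for both signs. -/
structure TwinCS (I : Type u) : Type (max u (v + 1)) where
  /-- The positive chamber set. -/
  Cp : Type v
  /-- The negative chamber set. -/
  Cm : Type v
  /-- `i`-adjacency on `Cp`. -/
  adjp : I → Cp → Cp → Prop
  /-- `i`-adjacency on `Cm`. -/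
  adjm : I → Cm → Cm → Prop
  eqvp : ∀ i, Equivalence (adjp i)
  eqvm : ∀ i, Equivalence (adjm i)
  /-- The opposition relation between `Cp` and `Cm`. -/
  op : Cp → Cm → Prop
  tcs1p : ∀ (i j : I) (c d : Cp) (x y : Cm), adjp i c d → adjm j x y →
    op d x → op c x → op c y → op d y ∨ j = i
  tcs1m : ∀ (i j : I) (c d : Cm) (x y : Cp), adjm i c d → adjp j x y →
    op x d → op x c → op y c → op y d ∨ j = i
  tcs2p : ∀ (i : I) (c d : Cp) (x : Cm), adjp i c d → op c x →
    ∃ y : Cm, adjm i x y ∧ op c y ∧ op d y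
  tcs2m : ∀ (i : I) (c d : Cm) (x : Cp), adjm i c d → op x c →
    ∃ y : Cp, adjp i x y ∧ op y c ∧ op y d
  tcs3p : ∀ (c : Cp) (x y : Cm), op c x → op c y →
    Relation.ReflTransGen (fun u v => op c u ∧ op c v ∧ Adj adjm u v) x y
  tcs3pJ : ∀ (c : Cp) (J : Set I), J.Finite → J.ncard ≤ 2 → ∀ x y : Cm, op c x → op c y →
    InResidue adjm J x y →
    Relation.ReflTransGen (fun u v => op c u ∧ op c v ∧ JAdj adjm J u v) x y
  tcs3m : ∀ (c : Cm) (x y : Cp), op x c → op y c →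
    Relation.ReflTransGen (fun u v => op u c ∧ op v c ∧ Adj adjp u v) x y
  tcs3mJ : ∀ (c : Cm) (J : Set I), J.Finite → J.ncard ≤ 2 → ∀ x y : Cp, op x c → op y c →
    InResidue adjp J x y →
    Relation.ReflTransGen (fun u v => op u c ∧ op v c ∧ JAdj adjp J u v) x y
  tcs4p : ∀ c : Cp, ∃ ω : Cm → Cp,
    (∀ (i : I) (x y : Cm), adjm i x y → adjp i (ω x) (ω y)) ∧
    (∀ x, op (ω x) x) ∧ (∀ x, op c x → ω x = c)
  tcs4m : ∀ c : Cm, ∃ ω : Cp → Cm,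
    (∀ (i : I) (x y : Cp), adjp i x y → adjm i (ω x) (ω y)) ∧
    (∀ x, op x (ω x)) ∧ (∀ x, op x c → ω x = c)

/-- The chambers of `Opp(𝒞)`: pairs of opposite chambers. -/
def OppC (T : TwinCS.{u, v} I) : Type v := {p : T.Cp × T.Cm // T.op p.1 p.2}

/-- `i`-adjacency on `Opp(𝒞)`: componentwise `i`-adjacency. -/
def oppAdj (T : TwinCS.{u, v} I) : I → OppC T → OppC T → Prop :=
  fun i u v => T.adjp i u.1.1 v.1.1 ∧ T.adjm i u.1.2 v.1.2

/-- A twin chamber system is simply connected if both of its halves are simply connected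
chamber systems. -/
def TwinSC (T : TwinCS.{u, v} I) : Prop :=
  SimplyConnected T.adjp ∧ SimplyConnected T.adjm


section Walks

variable {α β : Type*}

/-- `Walk r p q L`: the list `L` starts at `p`, ends at `q`, and consecutive entries are related
by `r`. -/
inductive Walk (r : α → α → Prop) : α → α → List α → Prop
  | single (p : α) : Walk r p p [p]
  | cons {p p' q : α} {L : List α} : r p p' → Walk r p' q L → Walk r p q (p :: L)

namespace Walk

variable {r s : α → α → Prop} {p q p' q' : α} {L L' : List α}

theorem head?_eq (h : Walk r p q L) : L.head? = some p := by
  cases h <;> rfl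

theorem ne_nil (h : Walk r p q L) : L ≠ [] := by
  cases h <;> simp

theorem exists_eq_cons (h : Walk r p q L) : ∃ L', L = p :: L' := by
  cases h <;> exact ⟨_, rfl⟩

theorem getLast?_eq (h : Walk r p q L) : L.getLast? = some q := by
  induction h with
  | single => rfl
  | cons _ hw ih =>
    obtain ⟨L', rfl⟩ := hw.exists_eq_cons
    rw [List.getLast?_cons_cons, ih]

theorem isChain (h : Walk r p q L) : L.IsChain r := by
  induction h with
  | single => exact List.isChain_singleton _
  | cons hr hw ih =>
    obtain ⟨L', rfl⟩ := hw.exists_eq_cons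
    exact List.isChain_cons_cons.2 ⟨hr, ih⟩

theorem of_isChain (h : L.IsChain r) (hp : L.head? = some p) (hq : L.getLast? = some q) :
    Walk r p q L := by
  induction L generalizing p with
  | nil => simp at hp
  | cons a L ih =>
    obtain rfl : a = p := by simpa using hp
    cases L with
    | nil =>
      obtain rfl : a = q := by simpa using hq
      exact single a
    | cons b L =>
      rw [List.isChain_cons_cons] at h
      exact cons h.1 (ih h.2 rfl (by rwa [List.getLast?_cons_cons] at hq))

theorem reflTransGen (h : Walk r p q L) : Relation.ReflTransGen r p q := by
  induction h with
  | single => exact .refl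
  | cons hr _ ih => exact .head hr ih

theorem exists_of_reflTransGen (h : Relation.ReflTransGen r p q) : ∃ L, Walk r p q L := by
  induction h using Relation.ReflTransGen.head_induction_on with
  | refl => exact ⟨_, single q⟩
  | head hr _ ih =>
    obtain ⟨L, hL⟩ := ih
    exact ⟨_, cons hr hL⟩

theorem map {t : β → β → Prop} (f : α → β) (hf : ∀ a b, r a b → t (f a) (f b))
    (h : Walk r p q L) : Walk t (f p) (f q) (L.map f) := by
  induction h with
  | single p => exact single (f p)
  | cons hr _ ih => exact cons (hf _ _ hr) ih

theorem mono (hrs : ∀ a b, r a b → s a b) (h : Walk r p q L) : Walk s p q L := by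
  simpa using h.map id hrs

theorem append (h : Walk r p q L) (hr : r q q') (h' : Walk r q' p' L') :
    Walk r p p' (L ++ L') := by
  induction h with
  | single => exact cons hr h'
  | cons hs _ ih => exact cons hs (ih hr)

theorem join (h : Walk r p q L) (h' : Walk r q q' (q :: L')) : Walk r p q' (L ++ L') := by
  induction h with
  | single => exact h'
  | cons hr _ ih => exact cons hr (ih h')

theorem split (h : Walk r p q (L ++ L')) (hL : L ≠ []) :
    ∃ m, Walk r p m L ∧ Walk r m q (m :: L') := by
  induction L generalizing p with
  | nil => exact absurd rfl hL
  | cons a L ih =>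
    obtain ⟨_, h'⟩ := h.exists_eq_cons
    obtain rfl : a = p := (List.cons.inj h').1
    cases L with
    | nil => exact ⟨a, single a, h⟩
    | cons b L =>
      cases h with
      | cons hr hw =>
        obtain ⟨m, h1, h2⟩ := ih hw (by simp)
        exact ⟨m, cons hr h1, h2⟩

theorem replace_suffix {A : List α} (h : Walk r p q (A ++ p' :: L)) :
    Walk r p' q (p' :: L) ∧
      ∀ m L', Walk r p' m (p' :: L') → Walk r p m (A ++ p' :: L') := by
  induction A generalizing p with
  | nil =>
    obtain ⟨_, h'⟩ := h.exists_eq_cons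
    obtain rfl : p' = p := (List.cons.inj h').1
    exact ⟨h, fun _ _ => id⟩
  | cons a A ih =>
    obtain ⟨_, h'⟩ := h.exists_eq_cons
    obtain rfl : a = p := (List.cons.inj h').1
    rw [List.cons_append] at h
    generalize hB : A ++ p' :: L = B at h
    cases h with
    | single => simp at hB
    | cons hr hw =>
      subst hB
      exact ⟨(ih hw).1, fun m L' hL' => cons hr ((ih hw).2 m L' hL')⟩

end Walk

end Walks

section Homotopy

variable {D : Type*} {adj : I → C → C → Prop} {G H K : List C}

theorem ElemHomotopic.symm (h : ElemHomotopic adj G H) : ElemHomotopic adj H G := by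
  obtain ⟨P, M, M', S, J, hJ, hJ2, h1, h2, h3, h4, h5, h6, h7, h8⟩ := h
  exact ⟨P, M', M, S, J, hJ, hJ2, h2, h1, h3.symm, h4.symm, h6, h5, h8, h7⟩

theorem ElemHomotopic.context (A B : List C) (h : ElemHomotopic adj G H) :
    ElemHomotopic adj (A ++ G ++ B) (A ++ H ++ B) := by
  obtain ⟨P, M, M', S, J, hJ, hJ2, h1, h2, h3, h4, h5, h6, rfl, rfl⟩ := h
  exact ⟨A ++ P, M, M', S ++ B, J, hJ, hJ2, h1, h2, h3, h4, h5, h6, by simp, by simp⟩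

theorem ElemHomotopic.map {adj' : I → D → D → Prop} (f : C → D)
    (hf : ∀ i c d, adj i c d → adj' i (f c) (f d)) (h : ElemHomotopic adj G H) :
    ElemHomotopic adj' (G.map f) (H.map f) := by
  obtain ⟨P, M, M', S, J, hJ, hJ2, h1, h2, h3, h4, h5, h6, rfl, rfl⟩ := h
  have hJf : ∀ c d, JAdj adj J c d → JAdj adj' J (f c) (f d) :=
    fun c d ⟨j, hj, hcd⟩ => ⟨j, hj, hf j c d hcd⟩
  refine ⟨P.map f, M.map f, M'.map f, S.map f, J, hJ, hJ2, by simpa, by simpa, ?_, ?_,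
    List.isChain_map_of_isChain f hJf h5, List.isChain_map_of_isChain f hJf h6,
    by simp, by simp⟩
  · rw [List.head?_map, List.head?_map, h3]
  · rw [List.getLast?_map, List.getLast?_map, h4]

namespace Homotopic

theorem refl (G : List C) : Homotopic adj G G := Relation.ReflTransGen.refl

theorem trans (h : Homotopic adj G H) (h' : Homotopic adj H K) : Homotopic adj G K :=
  Relation.ReflTransGen.trans h h'

instance : Trans (Homotopic adj) (Homotopic adj) (Homotopic adj) := ⟨trans⟩

theorem symm (h : Homotopic adj G H) : Homotopic adj H G :=
  have : Std.Symm (ElemHomotopic adj) := ⟨fun _ _ => ElemHomotopic.symm⟩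
  Relation.ReflTransGen.stdSymm.symm _ _ h

theorem context (A B : List C) (h : Homotopic adj G H) :
    Homotopic adj (A ++ G ++ B) (A ++ H ++ B) :=
  Relation.ReflTransGen.lift (fun L => A ++ L ++ B) (fun _ _ => ElemHomotopic.context A B) _ _ h

theorem append_left (A : List C) (h : Homotopic adj G H) : Homotopic adj (A ++ G) (A ++ H) := by
  simpa using h.context A []

theorem append_right (B : List C) (h : Homotopic adj G H) :
    Homotopic adj (G ++ B) (H ++ B) := by
  simpa using h.context [] B

theorem map {adj' : I → D → D → Prop} (f : C → D)
    (hf : ∀ i c d, adj i c d → adj' i (f c) (f d)) (h : Homotopic adj G H) :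
    Homotopic adj' (G.map f) (H.map f) :=
  Relation.ReflTransGen.lift (List.map f) (fun _ _ => ElemHomotopic.map f hf) _ _ h

theorem of_walks {J : Set I} (hJ : J.Finite) (hJ2 : J.ncard ≤ 2) {c d : C}
    (hG : Walk (JAdj adj J) c d G) (hH : Walk (JAdj adj J) c d H) : Homotopic adj G H :=
  .single ⟨[], G, H, [], J, hJ, hJ2, hG.ne_nil, hH.ne_nil, hG.head?_eq.trans hH.head?_eq.symm,
    hG.getLast?_eq.trans hH.getLast?_eq.symm, hG.isChain, hH.isChain, by simp, by simp⟩

theorem stutter [Nonempty I] (hadj : ∀ i c, adj i c c) (c : C) : Homotopic adj [c, c] [c] := by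
  obtain ⟨i⟩ := ‹Nonempty I›
  exact of_walks (J := {i}) (Set.finite_singleton i) (by simp)
    (.cons ⟨i, rfl, hadj i c⟩ (.single c)) (.single c)

theorem stutter_head [Nonempty I] (hadj : ∀ i c, adj i c c) {r : C → C → Prop} {c d : C}
    (hG : Walk r c d G) : Homotopic adj (c :: G) G := by
  obtain ⟨G', rfl⟩ := hG.exists_eq_cons
  exact (stutter hadj c).append_right G'

theorem stutter_last [Nonempty I] (hadj : ∀ i c, adj i c c) {r : C → C → Prop} {c d : C}
    (hG : Walk r c d G) : Homotopic adj (G ++ [d]) G := by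
  induction hG with
  | single c => exact stutter hadj c
  | @cons p _ _ L _ _ ih => exact ih.append_left [p]

end Homotopic

end Homotopy

section Opposite

open Set

variable {T : TwinCS.{u, v} I}

theorem oppAdj_refl (T : TwinCS.{u, v} I) (i : I) (p : OppC T) : oppAdj T i p p :=
  ⟨(T.eqvp i).refl _, (T.eqvm i).refl _⟩

theorem oppAdj_symm {i : I} {p q : OppC T} (h : oppAdj T i p q) : oppAdj T i q p :=
  ⟨(T.eqvp i).symm h.1, (T.eqvm i).symm h.2⟩

/-- The projection of `Opp(𝒞)` to the positive half. -/
def pos (p : OppC T) : T.Cp := p.1.1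

/-- `J`-adjacency inside a fibre of the projection of `Opp(𝒞)` to the positive half. -/
def FibAdj (T : TwinCS.{u, v} I) (J : Set I) (p q : OppC T) : Prop :=
  pos p = pos q ∧ JAdj (oppAdj T) J p q

theorem JAdj.univ {adj : I → C → C → Prop} {J : Set I} {c d : C} (h : JAdj adj J c d) :
    JAdj adj univ c d :=
  let ⟨j, _, hj⟩ := h
  ⟨j, mem_univ j, hj⟩

theorem jAdj_pos {J : Set I} (p q : OppC T) (h : JAdj (oppAdj T) J p q) :
    JAdj T.adjp J (pos p) (pos q) :=
  let ⟨j, hj, hpq⟩ := h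
  ⟨j, hj, hpq.1⟩

theorem fibAdj_refl [Nonempty I] (p : OppC T) : FibAdj T univ p p :=
  ⟨rfl, Classical.arbitrary I, mem_univ _, oppAdj_refl T _ p⟩

theorem Walk.fib_univ {J : Set I} {p q : OppC T} {F : List (OppC T)}
    (h : Walk (FibAdj T J) p q F) : Walk (FibAdj T univ) p q F :=
  h.mono fun _ _ hab => ⟨hab.1, hab.2.univ⟩

theorem Walk.fib_jAdj {J : Set I} {p q : OppC T} {F : List (OppC T)}
    (h : Walk (FibAdj T J) p q F) : Walk (JAdj (oppAdj T) J) p q F :=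
  h.mono fun _ _ hab => hab.2

theorem reflTransGen_fibAdj {J : Set I} {c : T.Cp} {x y : T.Cm} (hx : T.op c x) (hy : T.op c y)
    (h : Relation.ReflTransGen (fun u v => T.op c u ∧ T.op c v ∧ JAdj T.adjm J u v) x y) :
    Relation.ReflTransGen (FibAdj T J) (⟨(c, x), hx⟩ : OppC T) ⟨(c, y), hy⟩ := by
  induction h with
  | refl => exact .refl
  | tail _ hr ih =>
    obtain ⟨j, hj, hadj⟩ := hr.2.2
    exact (ih hr.1).tail ⟨rfl, j, hj, (T.eqvp j).refl c, hadj⟩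

/-- Any two chambers of a fibre are joined by a gallery in the fibre. -/
theorem exists_fibre_walk {p q : OppC T} (h : pos p = pos q) :
    ∃ F, Walk (FibAdj T univ) p q F := by
  obtain ⟨⟨c, x⟩, hx⟩ := p
  obtain ⟨⟨d, y⟩, hy⟩ := q
  obtain rfl : c = d := h
  refine Walk.exists_of_reflTransGen (reflTransGen_fibAdj hx hy ?_)
  refine Relation.ReflTransGen.mono (fun a b hab => ⟨hab.1, hab.2.1, ?_⟩) _ _
    (T.tcs3p c x y hx hy)
  obtain ⟨i, hi⟩ := hab.2.2
  exact ⟨i, mem_univ i, hi⟩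

/-- Two chambers of a fibre in a common residue of rank at most two are joined by a gallery inside
the fibre and the residue. -/
theorem exists_fibre_walk_residue {J : Set I} (hJ : J.Finite) (hJ2 : J.ncard ≤ 2) {p q : OppC T}
    (h : pos p = pos q) (hpq : Relation.ReflTransGen (JAdj (oppAdj T) J) p q) :
    ∃ F, Walk (FibAdj T J) p q F := by
  obtain ⟨⟨c, x⟩, hx⟩ := p
  obtain ⟨⟨d, y⟩, hy⟩ := q
  obtain rfl : c = d := h
  refine Walk.exists_of_reflTransGen (reflTransGen_fibAdj hx hy ?_)
  refine T.tcs3pJ c J hJ hJ2 x y hx hy ?_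
  exact hpq.lift (fun p : OppC T => p.1.2) fun _ _ ⟨j, hj, hab⟩ => ⟨j, hj, hab.2⟩

/-- Galleries in a common residue of rank at most two, with the same initial chamber and with final
chambers in the same fibre, are homotopic up to a gallery in that fibre. -/
theorem exists_fibre_correction [Nonempty I] {J : Set I} (hJ : J.Finite) (hJ2 : J.ncard ≤ 2)
    {p q q' : OppC T} {L L' : List (OppC T)} (hL : Walk (JAdj (oppAdj T) J) p q L)
    (hL' : Walk (JAdj (oppAdj T) J) p q' L') (h : pos q = pos q') :
    ∃ F, Walk (FibAdj T univ) q q' F ∧ Homotopic (oppAdj T) L' (L ++ F) := by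
  have : Std.Symm (JAdj (oppAdj T) J) := ⟨fun _ _ ⟨j, hj, hab⟩ => ⟨j, hj, oppAdj_symm hab⟩⟩
  obtain ⟨F, hF⟩ := exists_fibre_walk_residue hJ hJ2 h
    ((Relation.ReflTransGen.stdSymm.symm _ _ hL.reflTransGen).trans hL'.reflTransGen)
  obtain ⟨F', rfl⟩ := hF.exists_eq_cons
  refine ⟨_, hF.fib_univ, (Homotopic.of_walks hJ hJ2 hL' (hL.join hF.fib_jAdj)).trans ?_⟩
  simpa using (Homotopic.stutter_last (oppAdj_refl T) hL).symm.append_right F'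

theorem ncard_pair_le_two (i j : I) : ({i, j} : Set I).ncard ≤ 2 := by
  simpa using ncard_insert_le i {j}

theorem exists_lift_adj {i : I} {p : OppC T} {d : T.Cp} (h : T.adjp i (pos p) d) :
    ∃ q : OppC T, pos q = d ∧ oppAdj T i p q := by
  obtain ⟨y, hxy, -, hdy⟩ := T.tcs2p i _ d p.1.2 h p.2
  exact ⟨⟨(d, y), hdy⟩, rfl, h, hxy⟩

/-- Galleries of the positive half lift to `Opp(𝒞)`, with prescribed initial chamber. -/
theorem exists_lift {J : Set I} {c d : T.Cp} {M : List T.Cp} (hM : Walk (JAdj T.adjp J) c d M)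
    (p : OppC T) (hp : pos p = c) :
    ∃ q L, Walk (JAdj (oppAdj T) J) p q L ∧ L.map pos = M ∧ pos q = d := by
  induction hM generalizing p with
  | single => exact ⟨p, [p], .single p, by simp [hp], hp⟩
  | cons hr _ ih =>
    subst hp
    obtain ⟨j, hj, hadj⟩ := hr
    obtain ⟨p', hp', hpp'⟩ := exists_lift_adj hadj
    obtain ⟨q, L, hL, rfl, hq⟩ := ih p' hp'
    exact ⟨q, p :: L, .cons ⟨j, hj, hpp'⟩ hL, rfl, hq⟩

/-- A gallery in a fibre can be moved across an adjacency of the positive half. -/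
theorem exists_transport_edge [Nonempty I] {p p' q q' : OppC T} {F : List (OppC T)}
    (hF : Walk (FibAdj T univ) p p' F) (hpq : JAdj (oppAdj T) univ p q)
    (hpq' : JAdj (oppAdj T) univ p' q') (h : pos q = pos q') :
    ∃ F', Walk (FibAdj T univ) q q' F' ∧
      Homotopic (oppAdj T) (F ++ [q']) ([p, q] ++ F') := by
  induction hF generalizing q with
  | single p =>
    obtain ⟨i, -, hi⟩ := hpq
    obtain ⟨j, -, hj⟩ := hpq'
    exact exists_fibre_correction (J := {i, j}) (by simp) (ncard_pair_le_two i j)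
      (.cons ⟨i, by simp, hi⟩ (.single q)) (.cons ⟨j, by simp, hj⟩ (.single q')) h
  | @cons p p₁ p' L hr hw ih =>
    obtain ⟨i, -, hi⟩ := hpq
    obtain ⟨hpp, j, -, hj⟩ := hr
    have hadj : T.adjp i (pos p₁) (pos q) := hpp ▸ hi.1
    obtain ⟨q₁, hq₁, hi₁⟩ := exists_lift_adj hadj
    obtain ⟨F₁, hF₁, hhom₁⟩ := exists_fibre_correction (J := {i, j}) (L := [p, q])
      (L' := [p, p₁, q₁]) (by simp) (ncard_pair_le_two i j)
      (.cons ⟨i, by simp, hi⟩ (.single q))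
      (.cons ⟨j, by simp, hj⟩ (.cons ⟨i, by simp, hi₁⟩ (.single q₁))) hq₁.symm
    obtain ⟨F₂, hF₂, hhom₂⟩ := ih ⟨i, mem_univ i, hi₁⟩ hpq' (hq₁.trans h)
    refine ⟨F₁ ++ F₂, hF₁.append (fibAdj_refl q₁) hF₂, ?_⟩
    calc Homotopic (oppAdj T) (p :: L ++ [q']) ([p] ++ ([p₁, q₁] ++ F₂)) :=
          hhom₂.append_left [p]
      Homotopic (oppAdj T) _ ([p, q] ++ (F₁ ++ F₂)) := by
          simpa using hhom₁.append_right F₂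

/-- A gallery in a fibre can be moved along a gallery of the positive half. -/
theorem exists_transport [Nonempty I] {p p' q q' : OppC T} {F L L' : List (OppC T)}
    (hL' : Walk (JAdj (oppAdj T) univ) p' q' L') (hL : Walk (JAdj (oppAdj T) univ) p q L)
    (hmap : L.map pos = L'.map pos) (hF : Walk (FibAdj T univ) p p' F) :
    ∃ F', Walk (FibAdj T univ) q q' F' ∧ Homotopic (oppAdj T) (F ++ L') (L ++ F') := by
  induction hL' generalizing p L F with
  | single p' =>
    cases hL with
    | single =>
      exact ⟨F, hF, (Homotopic.stutter_last (oppAdj_refl T) hF).trans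
        (Homotopic.stutter_head (oppAdj_refl T) hF).symm⟩
    | cons _ hw =>
      obtain ⟨L'', rfl⟩ := hw.exists_eq_cons
      simp at hmap
  | @cons p' p₁' q' L' hr' hw' ih =>
    cases hL with
    | single =>
      obtain ⟨L'', rfl⟩ := hw'.exists_eq_cons
      simp at hmap
    | @cons _ p₁ _ L hr hw =>
      have hmap' : L.map pos = L'.map pos := (List.cons.inj hmap).2
      have hpos : pos p₁ = pos p₁' := by
        have := congrArg List.head? hmap'
        simpa [hw.head?_eq, hw'.head?_eq] using this
      obtain ⟨F₁, hF₁, hhom₁⟩ := exists_transport_edge hF hr hr' hpos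
      obtain ⟨F₂, hF₂, hhom₂⟩ := ih hw hmap' hF₁
      refine ⟨F₂, hF₂, ?_⟩
      calc Homotopic (oppAdj T) (F ++ p' :: L') (F ++ L') := by
            simpa using (Homotopic.stutter_last (oppAdj_refl T) hF).append_right L'
        Homotopic (oppAdj T) _ (F ++ p₁' :: L') :=
            (Homotopic.stutter_head (oppAdj_refl T) hw').symm.append_left F
        Homotopic (oppAdj T) _ ([p, p₁] ++ (F₁ ++ L')) := by
            simpa using hhom₁.append_right L'
        Homotopic (oppAdj T) _ ([p, p₁] ++ (L ++ F₂)) := hhom₂.append_left _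
        Homotopic (oppAdj T) _ (p :: L ++ F₂) := by
            simpa using
              (Homotopic.stutter_head (oppAdj_refl T) hw).context [p] F₂

/-- Closed galleries inside a fibre are null-homotopic: the fibre embeds in the simply connected
negative half, which maps to `Opp(𝒞)` by (TCS4). -/
theorem homotopic_single_of_fibre (hT : SimplyConnected T.adjm) {p : OppC T}
    {F : List (OppC T)} (hF : Walk (FibAdj T univ) p p F) : Homotopic (oppAdj T) F [p] := by
  obtain ⟨ω, hω, hωop, hωc⟩ := T.tcs4p (pos p)
  let g : T.Cm → OppC T := fun x => ⟨(ω x, x), hωop x⟩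
  have hneg : Walk (Adj T.adjm) p.1.2 p.1.2 (F.map fun q : OppC T => q.1.2) :=
    hF.map (fun q : OppC T => q.1.2) fun _ _ ⟨_, j, _, hab⟩ => ⟨j, hab.2⟩
  obtain ⟨x, hx, hnull⟩ := hT.2 _ ⟨hneg.ne_nil, hneg.isChain⟩
    (hneg.head?_eq.trans hneg.getLast?_eq.symm)
  obtain rfl : p.1.2 = x := by simpa [hneg.head?_eq] using hx
  have hg : ∀ q : OppC T, pos p = pos q → g q.1.2 = q := fun q hq =>
    Subtype.ext (Prod.ext ((hωc q.1.2 (hq ▸ q.2)).trans hq) rfl)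
  have hmem : ∀ {a b : OppC T} {L : List (OppC T)}, Walk (FibAdj T univ) a b L →
      ∀ q ∈ L, pos a = pos q := by
    intro a b L hL
    induction hL with
    | single => simp
    | cons hr _ ih =>
      intro q hq
      rcases List.mem_cons.1 hq with rfl | hq
      · rfl
      · exact hr.1.trans (ih q hq)
  have hF' : F.map (fun q : OppC T => g q.1.2) = F :=
    (List.map_congr_left fun q hq => hg q (hmem hF q hq)).trans (List.map_id F)
  have hhom := hnull.map (adj' := oppAdj T) g fun i x y hxy => ⟨hω i x y hxy, hxy⟩
  rw [List.map_map, List.map_singleton, hg p rfl] at hhom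
  rwa [← hF']

/-- Elementary homotopies of the positive half lift to `Opp(𝒞)`, up to a gallery in a fibre. -/
theorem exists_lift_elemHomotopic [Nonempty I] {p q : OppC T} {L : List (OppC T)}
    {H : List T.Cp} (hL : Walk (JAdj (oppAdj T) univ) p q L)
    (h : ElemHomotopic T.adjp (L.map pos) H) :
    ∃ q' L' F, Walk (JAdj (oppAdj T) univ) p q' L' ∧ L'.map pos = H ∧
      Walk (FibAdj T univ) q' q F ∧ Homotopic (oppAdj T) L (L' ++ F) := by
  obtain ⟨P, M, M', S, J, hJ, hJ2, hM, hM', hhead, hlast, hMJ, hMJ', hG, rfl⟩ := h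
  obtain ⟨AB, D, rfl, hAB, rfl⟩ := List.map_eq_append_iff.1 hG
  obtain ⟨A, B, rfl, rfl, rfl⟩ := List.map_eq_append_iff.1 hAB
  obtain ⟨b₀, B, rfl⟩ := List.exists_cons_of_ne_nil (l := B) (by rintro rfl; simp at hM)
  obtain ⟨hBD, hrep⟩ := Walk.replace_suffix (A := A) (p' := b₀) (L := B ++ D)
    (by simpa using hL)
  obtain ⟨b₁, hB, hD⟩ := Walk.split (L := b₀ :: B) hBD (by simp)
  have hBpos := hB.map pos jAdj_pos
  have hwM : Walk (JAdj T.adjp J) (pos b₀) (pos b₁) ((b₀ :: B).map pos) :=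
    .of_isChain hMJ hBpos.head?_eq hBpos.getLast?_eq
  have hwM' : Walk (JAdj T.adjp J) (pos b₀) (pos b₁) M' :=
    .of_isChain hMJ' (hhead ▸ hBpos.head?_eq) (hlast ▸ hBpos.getLast?_eq)
  obtain ⟨b₂, B₂, hB₂, hB₂map, hb₂⟩ := exists_lift hwM b₀ rfl
  obtain ⟨b', B', hB', rfl, hb'⟩ := exists_lift hwM' b₀ rfl
  obtain ⟨F₂, hF₂, hhom₂⟩ := exists_transport hB (hB₂.mono fun _ _ => JAdj.univ) hB₂map
    (.single b₀)
  obtain ⟨F₃, hF₃, hhom₃⟩ := exists_fibre_correction hJ hJ2 hB' hB₂ (hb'.trans hb₂.symm)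
  have hF₄ := hF₃.append (fibAdj_refl b₂) hF₂
  obtain ⟨q', E, hE, hEmap, -⟩ := exists_lift (hD.map pos jAdj_pos) b' hb'
  obtain ⟨D', rfl⟩ := hE.exists_eq_cons
  obtain ⟨F₅, hF₅, hhom₅⟩ := exists_transport hD hE hEmap hF₄
  have hBhom : Homotopic (oppAdj T) (b₀ :: B) (B' ++ (F₃ ++ F₂)) :=
    calc Homotopic (oppAdj T) (b₀ :: B) ([b₀] ++ b₀ :: B) :=
          (Homotopic.stutter_head (oppAdj_refl T) hB).symm
      Homotopic (oppAdj T) _ (B₂ ++ F₂) := hhom₂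
      Homotopic (oppAdj T) _ (B' ++ (F₃ ++ F₂)) := by simpa using hhom₃.append_right F₂
  have hB'u : Walk (JAdj (oppAdj T) univ) b₀ b' B' := hB'.mono fun _ _ => JAdj.univ
  obtain ⟨B'', rfl⟩ := hB'u.exists_eq_cons
  refine ⟨q', A ++ b₀ :: B'' ++ D', F₅, ?_, ?_, hF₅, ?_⟩
  · simpa using hrep q' (B'' ++ D') (hB'u.join hE)
  · simp [(List.cons.inj hEmap).2]
  · calc Homotopic (oppAdj T) (A ++ b₀ :: B ++ D) (A ++ (b₀ :: B ++ [b₁]) ++ D) :=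
          ((Homotopic.stutter_last (oppAdj_refl T) hB).symm.context A D)
      Homotopic (oppAdj T) _ (A ++ (b₀ :: B'' ++ (F₃ ++ F₂) ++ [b₁]) ++ D) :=
          (hBhom.append_right [b₁]).context A D
      Homotopic (oppAdj T) _ (A ++ b₀ :: B'' ++ (b' :: D' ++ F₅)) := by
          simpa using hhom₅.append_left (A ++ b₀ :: B'')
      Homotopic (oppAdj T) _ (A ++ b₀ :: B'' ++ D' ++ F₅) := by
          simpa using
            (Homotopic.stutter_last (oppAdj_refl T) hB'u).context A (D' ++ F₅)

/-- Homotopies of the positive half lift to `Opp(𝒞)`, up to a gallery in a fibre. -/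
theorem exists_lift_homotopic [Nonempty I] {p q : OppC T} {L : List (OppC T)}
    {H : List T.Cp} (hL : Walk (JAdj (oppAdj T) univ) p q L)
    (h : Homotopic T.adjp (L.map pos) H) :
    ∃ q' L' F, Walk (JAdj (oppAdj T) univ) p q' L' ∧ L'.map pos = H ∧
      Walk (FibAdj T univ) q' q F ∧ Homotopic (oppAdj T) L (L' ++ F) := by
  induction h with
  | refl =>
    exact ⟨q, L, [q], hL, rfl, .single q, (Homotopic.stutter_last (oppAdj_refl T) hL).symm⟩
  | tail _ hstep ih =>
    obtain ⟨q₁, L₁, F₁, hL₁, rfl, hF₁, hhom₁⟩ := ih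
    obtain ⟨q₂, L₂, F₂, hL₂, hmap, hF₂, hhom₂⟩ := exists_lift_elemHomotopic hL₁ hstep
    refine ⟨q₂, L₂, F₂ ++ F₁, hL₂, hmap, hF₂.append (fibAdj_refl q₁) hF₁, hhom₁.trans ?_⟩
    simpa using hhom₂.append_right F₁

theorem connected_opp (hT : Connected T.adjp) : Connected (oppAdj T) := by
  intro p q
  have hpq : Relation.ReflTransGen (JAdj T.adjp univ) (pos p) (pos q) :=
    Relation.ReflTransGen.mono (fun _ _ ⟨i, hi⟩ => ⟨i, mem_univ i, hi⟩) _ _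
      (hT (pos p) (pos q))
  obtain ⟨M, hM⟩ := Walk.exists_of_reflTransGen hpq
  obtain ⟨q', L, hL, -, hq'⟩ := exists_lift hM p rfl
  obtain ⟨F, hF⟩ := exists_fibre_walk hq'
  exact Relation.ReflTransGen.mono (fun _ _ ⟨i, _, hi⟩ => ⟨i, hi⟩) _ _
    (hL.reflTransGen.trans hF.fib_jAdj.reflTransGen)

end Opposite

/-- If `𝒞` is a simply connected twin chamber system over `I`, then the chamber
system `Opp(𝒞)` is simply connected. -/
theorem opp_simplyConnected {I : Type u} (T : TwinCS.{u, v} I) (hT : TwinSC T) :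
    SimplyConnected (oppAdj T) := by
  refine ⟨connected_opp hT.1.1, fun G hG hclosed => ?_⟩
  obtain ⟨p, G, rfl⟩ := List.exists_cons_of_ne_nil hG.1
  refine ⟨p, rfl, ?_⟩
  rcases isEmpty_or_nonempty I with hI | hI
  · cases G with
    | nil => exact .refl _
    | cons q G =>
      obtain ⟨i, -⟩ := (List.isChain_cons_cons.1 hG.2).1
      exact isEmptyElim i
  have hL : Walk (JAdj (oppAdj T) Set.univ) p p (p :: G) :=
    .of_isChain (hG.2.imp fun _ _ ⟨i, hi⟩ => ⟨i, Set.mem_univ i, hi⟩) rfl hclosed.symm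
  have hpos : Walk (Adj T.adjp) (pos p) (pos p) ((p :: G).map pos) :=
    hL.map pos fun _ _ ⟨i, _, hi⟩ => ⟨i, hi.1⟩
  obtain ⟨c, -, hnull⟩ := hT.1.2 _ ⟨hpos.ne_nil, hpos.isChain⟩
    (hpos.head?_eq.trans hpos.getLast?_eq.symm)
  obtain ⟨q, L', F, hL', hmap, hF, hhom⟩ := exists_lift_homotopic hL hnull
  cases hL' with
  | single =>
    exact hhom.trans ((Homotopic.stutter_head (oppAdj_refl T) hF).trans
      (homotopic_single_of_fibre hT.2 hF))
  | cons _ hw =>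
    obtain ⟨_, rfl⟩ := hw.exists_eq_cons
    simp at hmap

end TwinChamber
end

section
/- Let 𝒞 be a twin chamber system over a set I, let J ⊆ I, let c = (c⁺, c⁻) be a chamber of Opp(𝒞), and let d₁, d₂ ∈ R_J(c⁺) with d₁ ∼ᵢ d₂ for some i ∈ J. Then there exists y ∈ R_J(c⁻) such that d₁ op y and y op d₂. -/
/-! ## Chamber systems, galleries, homotopy, and twin chamber systems -/

namespace TwinChamber

universe u v

variable {I : Type u} {C : Type v}

/-- Let `𝒞` be a twin chamber system over `I`, `J ⊆ I`, `c = (c⁺, c⁻)` a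
chamber of `Opp(𝒞)`, and `d₁, d₂ ∈ R_J(c⁺)` with `d₁ ∼ᵢ d₂` for some `i ∈ J`. Then there is
`y ∈ R_J(c⁻)` with `d₁ op y` and `y op d₂`. -/
theorem exists_opposite_in_residue {I : Type u} (T : TwinCS.{u, v} I)
    (J : Set I) (i : I) (hi : i ∈ J)
    (cp : T.Cp) (cm : T.Cm) (hc : T.op cp cm)
    (d₁ d₂ : T.Cp)
    (hd₁ : InResidue T.adjp J cp d₁) (hd₂ : InResidue T.adjp J cp d₂)
    (hadj : T.adjp i d₁ d₂) :
    ∃ y : T.Cm, InResidue T.adjm J cm y ∧ T.op d₁ y ∧ T.op d₂ y := by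
  obtain ⟨ω, hω_adj, hω_op, hω_eq⟩ := T.tcs4m cm
  obtain ⟨y, hy, h₁, h₂⟩ := T.tcs2p i d₁ d₂ (ω d₁) hadj (hω_op d₁)
  have hres : InResidue T.adjm J (ω cp) (ω d₁) :=
    Relation.ReflTransGen.lift ω (fun a b ⟨j, hj, hab⟩ => ⟨j, hj, hω_adj j a b hab⟩) _ _ hd₁
  rw [hω_eq cp hc] at hres
  exact ⟨y, hres.tail ⟨i, hi, hy⟩, h₁, h₂⟩

end TwinChamber
end

section
/- Let 𝒞 be a simply connected twin chamber system over a set I. Then the chamber system Opp(𝒞) is connected. -/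
/-! ## Chamber systems, galleries, homotopy, and twin chamber systems -/

namespace TwinChamber

universe u v

variable {I : Type u} {C : Type v}

/-- The fibres of the projection from `Opp(𝒞)` to `𝒞₊` are connected. -/
theorem oppAdj_fibre_connected {I : Type u} (T : TwinCS.{u, v} I) (c : T.Cp) (x y : T.Cm)
    (hx : T.op c x) (hy : T.op c y) :
    Relation.ReflTransGen (Adj (oppAdj T)) ⟨(c, x), hx⟩ ⟨(c, y), hy⟩ := by
  have h := T.tcs3p c x y hx hy
  induction h with
  | refl => exact .refl
  | tail _ hbc ih =>
    obtain ⟨hb, _, i, hi⟩ := hbc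
    exact (ih hb).tail ⟨i, (T.eqvp i).refl c, hi⟩

/-- Galleries of `𝒞₊` lift to `Opp(𝒞)`, with a prescribed initial chamber. -/
theorem exists_lift_of_gallery {I : Type u} (T : TwinCS.{u, v} I) {c d : T.Cp}
    (h : Relation.ReflTransGen (Adj T.adjp) c d) (x : T.Cm) (hx : T.op c x) :
    ∃ (y : T.Cm) (hy : T.op d y),
      Relation.ReflTransGen (Adj (oppAdj T)) ⟨(c, x), hx⟩ ⟨(d, y), hy⟩ := by
  induction h with
  | refl => exact ⟨x, hx, .refl⟩
  | @tail b d _ hbd ih =>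
    obtain ⟨y, hy, hr⟩ := ih
    obtain ⟨i, hi⟩ := hbd
    obtain ⟨z, hyz, hbz, hdz⟩ := T.tcs2p i b d y hi hy
    refine ⟨z, hdz, (hr.tail (b := ⟨(b, y), hy⟩) (c := ⟨(b, z), hbz⟩) ?_).tail ?_⟩
    · exact ⟨i, (T.eqvp i).refl b, hyz⟩
    · exact ⟨i, hi, (T.eqvm i).refl z⟩

/-- If `𝒞` is a simply connected twin chamber system over `I`, then the chamber
system `Opp(𝒞)` is connected. -/
theorem opp_connected {I : Type u} (T : TwinCS.{u, v} I) (hT : TwinSC T) :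
    Connected (oppAdj T) := by
  rintro ⟨⟨c, x⟩, hx⟩ ⟨⟨d, y⟩, hy⟩
  obtain ⟨z, hz, hr⟩ := exists_lift_of_gallery T (hT.1.1 c d) x hx
  exact hr.trans (oppAdj_fibre_connected T d z y hz hy)

end TwinChamber
end

section
/- Let 𝒞 be a simply connected twin chamber system over a set I, let i ∈ I, let c, d ∈ 𝒞₊ with c ∼ᵢ d, and let (x₀, x₁, …, x_k) be a gallery contained in c^op such that x₀ op d and x_k op d. Then there exists a gallery (x_k = y₀, y₁, …, y_l = x₀) contained in d^op such that the closed gallery ((c,x₀), …, (c,x_k), (d,y₀), …, (d,y_l), (c,x₀)) is null-homotopic in Opp(𝒞). -/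
/-! ## Chamber systems, galleries, homotopy, and twin chamber systems -/

namespace TwinChamber

universe u v

variable {I : Type u} {C : Type v}

variable {T : TwinCS.{u, v} I}

theorem Homotopic.append_congr {adj : I → C → C → Prop} {G H : List C}
    (h : Homotopic adj G H) (P S : List C) : Homotopic adj (P ++ G ++ S) (P ++ H ++ S) := by
  refine Relation.ReflTransGen.lift (fun L => P ++ L ++ S) ?_ _ _ h
  rintro _ _ ⟨Q, M, M', R, J, hf, hc, hM, hM', hhd, hlt, hch, hch', rfl, rfl⟩
  exact ⟨P ++ Q, M, M', R ++ S, J, hf, hc, hM, hM', hhd, hlt, hch, hch',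
    by simp, by simp⟩

theorem ElemHomotopic.of_isChain {adj : I → C → C → Prop} (P M M' S : List C) {J : Set I}
    (hf : J.Finite) (hc : J.ncard ≤ 2) (hM : M ≠ []) (hM' : M' ≠ [])
    (hhd : M.head? = M'.head?) (hlt : M.getLast? = M'.getLast?)
    (hch : M.IsChain (JAdj adj J)) (hch' : M'.IsChain (JAdj adj J)) :
    ElemHomotopic adj (P ++ M ++ S) (P ++ M' ++ S) :=
  ⟨P, M, M', S, J, hf, hc, hM, hM', hhd, hlt, hch, hch', rfl, rfl⟩

/-- The chamber `(c, x)` of `Opp(𝒞)` for `x` opposite `c`. -/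
def oppMk (c : T.Cp) (x : {x : T.Cm // T.op c x}) : OppC T := ⟨(c, x.1), x.2⟩

theorem oppAdj_oppMk {c d : T.Cp} {j : I} (hcd : T.adjp j c d)
    {x : {x : T.Cm // T.op c x}} {y : {y : T.Cm // T.op d y}} (h : T.adjm j x.1 y.1) :
    oppAdj T j (oppMk c x) (oppMk d y) := ⟨hcd, h⟩

theorem isChain_map_oppMk (c : T.Cp) {J : Set I} {L : List {x : T.Cm // T.op c x}}
    (h : L.IsChain (fun x y => JAdj T.adjm J x.1 y.1)) :
    (L.map (oppMk c)).IsChain (JAdj (oppAdj T) J) := by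
  rw [List.isChain_map]
  exact h.imp fun x y ⟨j, hj, hxy⟩ => ⟨j, hj, oppAdj_oppMk ((T.eqvp j).refl c) hxy⟩

/-- (TCS3) for residues of rank at most two, phrased with lists. -/
theorem exists_chain_in_op (d : T.Cp) (J : Set I) (hf : J.Finite) (hc : J.ncard ≤ 2)
    (y z : {y : T.Cm // T.op d y}) (h : InResidue T.adjm J y.1 z.1) :
    ∃ W : List {y : T.Cm // T.op d y}, (W ++ [z]).head? = some y ∧
      (W ++ [z]).IsChain (fun u v => JAdj T.adjm J u.1 v.1) := by
  obtain ⟨y, hy⟩ := y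
  have key := T.tcs3pJ d J hf hc y z.1 hy z.2 h
  clear h
  induction key using Relation.ReflTransGen.head_induction_on with
  | refl => exact ⟨[], by simp⟩
  | head huv _ ih =>
    obtain ⟨W, hhd, hch⟩ := ih huv.2.1
    refine ⟨⟨_, hy⟩ :: W, by simp, ?_⟩
    rw [List.cons_append, List.isChain_cons]
    refine ⟨fun w hw => ?_, hch⟩
    rw [hhd, Option.mem_some_iff] at hw
    exact hw ▸ huv.2.2

/-- A gallery in `c^op`, together with chambers of `d^op` which are `i`-adjacent to its ends, can
be closed up through `d^op` to a null-homotopic gallery of `Opp(𝒞)`. -/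
theorem exists_homotopic_singleton {i : I} {c d : T.Cp} (hcd : T.adjp i c d)
    (X : List {x : T.Cm // T.op c x}) :
    ∀ (x₀ xk : {x : T.Cm // T.op c x}) (z₀ zk : {y : T.Cm // T.op d y}),
      (x₀ :: X).IsChain (fun x y => Adj T.adjm x.1 y.1) →
      (x₀ :: X).getLast? = some xk →
      T.adjm i x₀.1 z₀.1 → T.adjm i xk.1 zk.1 →
      ∃ Y : List {y : T.Cm // T.op d y}, (Y ++ [z₀]).head? = some zk ∧
        (Y ++ [z₀]).IsChain (fun x y => Adj T.adjm x.1 y.1) ∧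
        Homotopic (oppAdj T)
          ((x₀ :: X).map (oppMk c) ++ (Y ++ [z₀]).map (oppMk d) ++ [oppMk c x₀])
          [oppMk c x₀] := by
  have hdc := (T.eqvp i).symm hcd
  have hcc := fun j => (T.eqvp j).refl c
  induction X with
  | nil =>
    intro x₀ xk z₀ zk _ hl h₀ hk
    obtain rfl : x₀ = xk := by simpa using hl
    have hkz : T.adjm i zk.1 z₀.1 := (T.eqvm i).trans ((T.eqvm i).symm hk) h₀
    have hdd := (T.eqvp i).refl d
    refine ⟨[zk], by simp, by simpa using ⟨i, hkz⟩, .single ?_⟩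
    refine .of_isChain [] [oppMk c x₀, oppMk d zk, oppMk d z₀, oppMk c x₀] [oppMk c x₀] []
      (J := {i}) (by simp) (by simp) (by simp) (by simp) (by simp) (by simp) ?_ (by simp)
    simp only [List.isChain_cons_cons, List.isChain_singleton, and_true, JAdj,
      Set.mem_singleton_iff, exists_eq_left]
    exact ⟨oppAdj_oppMk hcd hk, oppAdj_oppMk hdd hkz, oppAdj_oppMk hdc ((T.eqvm i).symm h₀)⟩
  | cons x₁ X ih =>
    intro x₀ xk z₀ zk hch hl h₀ hk
    rw [List.isChain_cons_cons] at hch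
    obtain ⟨⟨t, ht⟩, hch⟩ := hch
    obtain ⟨z₁, h₁, -, hz₁⟩ := T.tcs2p i c d x₁.1 hcd x₁.2
    lift z₁ to {y : T.Cm // T.op d y} using hz₁
    obtain ⟨Y, hYh, hYc, hY⟩ := ih x₁ xk z₁ zk hch (by simpa using hl) h₁ hk
    have hf : ({i, t} : Set I).Finite := Set.toFinite _
    have hcard : ({i, t} : Set I).ncard ≤ 2 := by
      simpa using Set.ncard_insert_le i {t}
    have ht' := (T.eqvm t).symm ht
    obtain ⟨W, hWh, hWc⟩ := exists_chain_in_op d {i, t} hf hcard z₁ z₀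
      (((Relation.ReflTransGen.single ⟨i, by simp, (T.eqvm i).symm h₁⟩).tail
        ⟨t, by simp, ht'⟩).tail ⟨i, by simp, h₀⟩)
    refine ⟨Y ++ W, ?_, ?_, ?_⟩
    · cases Y with
      | nil => simpa [hWh] using hYh
      | cons y Y => simpa using hYh
    · rw [List.append_assoc, List.isChain_append]
      rw [List.isChain_append] at hYc
      refine ⟨hYc.1, hWc.imp fun _ _ ⟨j, _, hj⟩ => ⟨j, hj⟩, fun y hy w hw => ?_⟩
      rw [hWh] at hw
      exact hYc.2.2 y hy w (by simpa using hw)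
    · have hback : JAdj (oppAdj T) {i, t} (oppMk c x₁) (oppMk c x₀) :=
        ⟨t, by simp, oppAdj_oppMk (hcc t) ht'⟩
      have hdrop : ElemHomotopic (oppAdj T)
          ((x₀ :: x₁ :: X).map (oppMk c) ++ (Y ++ W ++ [z₀]).map (oppMk d) ++ [oppMk c x₀])
          ([oppMk c x₀] ++ ((x₁ :: X).map (oppMk c) ++ (Y ++ [z₁]).map (oppMk d) ++
            [oppMk c x₁]) ++ [oppMk c x₀]) := by
        have hloop := ElemHomotopic.of_isChain (adj := oppAdj T) (J := {i, t})
          ((x₀ :: x₁ :: X).map (oppMk c) ++ Y.map (oppMk d))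
          ((W ++ [z₀]).map (oppMk d) ++ [oppMk c x₀]) [oppMk d z₁, oppMk c x₁, oppMk c x₀] []
          hf hcard (by simp) (by simp) ?_ (by simp) ?_ ?_
        · simpa using hloop
        · rw [List.head?_append, List.head?_map, hWh]
          rfl
        · rw [List.isChain_append]
          refine ⟨isChain_map_oppMk d hWc, by simp, ?_⟩
          simpa using ⟨i, by simp, oppAdj_oppMk hdc ((T.eqvm i).symm h₀)⟩
        · exact .cons_cons ⟨i, by simp, oppAdj_oppMk hdc ((T.eqvm i).symm h₁)⟩
            (.cons_cons hback (.singleton _))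
      refine .head hdrop ((hY.append_congr [oppMk c x₀] [oppMk c x₀]).tail ?_)
      refine .of_isChain [] [oppMk c x₀, oppMk c x₁, oppMk c x₀] [oppMk c x₀] [] hf hcard
        (by simp) (by simp) (by simp) (by simp) ?_ (by simp)
      exact .cons_cons ⟨t, by simp, oppAdj_oppMk (hcc t) ht⟩
        (.cons_cons hback (.singleton _))

/-- Let `𝒞` be a simply connected twin chamber system, `i ∈ I`, `c ∼ᵢ d` in
`𝒞₊`, and `(x₀, …, x_k)` a gallery in `c^op` with `x₀ op d` and `x_k op d`. Then there is a
gallery `(x_k = y₀, …, y_l = x₀)` in `d^op` such that the closed gallery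
`((c,x₀), …, (c,x_k), (d,y₀), …, (d,y_l), (c,x₀))` is null-homotopic in `Opp(𝒞)`. -/
theorem nullHomotopic_of_gallery_in_op {I : Type u} (T : TwinCS.{u, v} I) (hT : TwinSC T)
    (i : I) (c d : T.Cp) (hcd : T.adjp i c d)
    (xs : List T.Cm) (hne : xs ≠ []) (hchain : xs.Chain' (Adj T.adjm))
    (hall : ∀ x ∈ xs, T.op c x)
    (x₀ xk : T.Cm) (hh : xs.head? = some x₀) (hl : xs.getLast? = some xk)
    (hd0 : T.op d x₀) (hdk : T.op d xk) :
    ∃ ys : List T.Cm, ys ≠ [] ∧ ys.head? = some xk ∧ ys.getLast? = some x₀ ∧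
      (∀ y ∈ ys, T.op d y) ∧ ys.Chain' (Adj T.adjm) ∧
      ∃ G : List (OppC T),
        G.map Subtype.val =
          xs.map (fun x => (c, x)) ++ ys.map (fun y => (d, y)) ++ [(c, x₀)] ∧
        IsGallery (oppAdj T) G ∧ NullHomotopic (oppAdj T) G := by
  lift xs to List {x : T.Cm // T.op c x} using hall
  obtain _ | ⟨x, X⟩ := xs
  · simp at hne
  obtain rfl : x.1 = x₀ := by simpa using hh
  obtain ⟨xl, hxl, rfl⟩ : ∃ a, (x :: X).getLast? = some a ∧ a.1 = xk := by
    simpa only [List.getLast?_map, Option.map_eq_some_iff] using hl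
  have hX : (x :: X).IsChain (fun a b => Adj T.adjm a.1 b.1) := (List.isChain_map _).1 hchain
  obtain ⟨Y, hYh, hYc, hY⟩ := exists_homotopic_singleton hcd X x xl ⟨x.1, hd0⟩ ⟨xl.1, hdk⟩ hX hxl
    ((T.eqvm i).refl _) ((T.eqvm i).refl _)
  have hlift : ∀ (e : T.Cp) (L : List {y : T.Cm // T.op e y}),
      L.IsChain (fun a b => Adj T.adjm a.1 b.1) →
      (L.map (oppMk e)).IsChain (Adj (oppAdj T)) := fun e L hL => by
    rw [List.isChain_map]
    exact hL.imp fun _ _ ⟨j, hj⟩ => ⟨j, oppAdj_oppMk ((T.eqvp j).refl e) hj⟩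
  refine ⟨(Y ++ [(⟨x.1, hd0⟩ : {y : T.Cm // T.op d y})]).map Subtype.val, by simp, ?_, by simp, ?_,
    (List.isChain_map Subtype.val).2 hYc, _, ?_, ⟨?_, ?_⟩, oppMk c x, ?_, hY⟩
  · rw [List.head?_map, hYh]
    rfl
  · intro y hy
    obtain ⟨a, -, rfl⟩ := List.mem_map.1 hy
    exact a.2
  · erw [List.map_append, List.map_append, List.map_map, List.map_map, List.map_map, List.map_map]
    rfl
  · simp
  · refine List.isChain_append.2 ⟨List.isChain_append.2 ⟨hlift c _ hX, hlift d _ hYc, ?_⟩,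
      by simp, ?_⟩
    · rw [List.getLast?_map, List.head?_map, hxl, hYh]
      simpa using ⟨i, oppAdj_oppMk hcd ((T.eqvm i).refl _)⟩
    · intro a ha b hb
      obtain rfl : oppMk d ⟨x.1, hd0⟩ = a := by
        rw [List.getLast?_append, List.getLast?_map, List.getLast?_concat] at ha
        simpa using ha
      obtain rfl : oppMk c x = b := by simpa using hb
      exact ⟨i, oppAdj_oppMk ((T.eqvp i).symm hcd) ((T.eqvm i).refl _)⟩
  · simp


end TwinChamber
end
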